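/- For every integer α ≥ 1 there exists ε₀ > 0 such that for all ε with 0 < ε ≤ ε₀ the following holds in the geometric graph H_b(α, ε): every walk that starts at s, ends at t, and whose associated polygonal path is increasing-chord passes, for each integer j with 1 ≤ j ≤ α, through exactly one of the two vertices p_{2j−1} and p_{2j}. -/

import Mathlib

open RealInnerProductSpace

noncomputable section

/-- The Euclidean plane `ℝ²`. -/
abbrev E2 : Type := EuclideanSpace ℝ (Fin 2)

/-- The point of `ℝ²` with coordinates `x`, `y`. -/
def pt (x y : ℝ) : E2 := (WithLp.equiv 2 (Fin 2 → ℝ)).symm ![x, y]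

/-- The piecewise-linear parametrization of the polygonal path with vertices
`v 0, v 1, …` : for `t ∈ [i, i+1]` it traverses the segment `[v i, v (i+1)]` linearly. -/
def polyPath (v : ℕ → E2) (t : ℝ) : E2 :=
  v ⌊t⌋₊ + (t - (⌊t⌋₊ : ℝ)) • (v (⌊t⌋₊ + 1) - v ⌊t⌋₊)

/-- The polygonal path with vertices `v 0, …, v n` is increasing-chord: for parameter
positions `a ⪯ b ⪯ c ⪯ d` in `[0, n]`, the distance between the points at `b` and `c`
is at most the distance between the points at `a` and `d`. -/
def IncreasingChord (n : ℕ) (v : ℕ → E2) : Prop :=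
  ∀ a b c d : ℝ, 0 ≤ a → a ≤ b → b ≤ c → c ≤ d → d ≤ (n : ℝ) →
    dist (polyPath v b) (polyPath v c) ≤ dist (polyPath v a) (polyPath v d)

/-- The slab of the segment `[x, y]`: points whose orthogonal projection onto the line
through `x` and `y` lies in the segment `[x, y]`. -/
def slab (x y : E2) : Set E2 :=
  {z | 0 ≤ ⟪z - x, y - x⟫ ∧ ⟪z - x, y - x⟫ ≤ ⟪y - x, y - x⟫}

/-- The point `p i = (2α + 1, −i²/(2α − i + 1))`, the intersection of `L i` with the
vertical line `x = 2α + 1`. -/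
def needleP (α i : ℕ) : E2 :=
  pt (2 * (α : ℝ) + 1) (-(i : ℝ) ^ 2 / (2 * (α : ℝ) - (i : ℝ) + 1))

/-- The point `p′ i = (2α + 1 − ε, −i²/(2α − i + 1) − ε(2α − i + 1)/i)`; the needle of
index `i` is the segment `[p i, p′ i]`, which is perpendicular to `L i`. -/
def needleP' (α : ℕ) (ε : ℝ) (i : ℕ) : E2 :=
  pt (2 * (α : ℝ) + 1 - ε)
    (-(i : ℝ) ^ 2 / (2 * (α : ℝ) - (i : ℝ) + 1) - ε * (2 * (α : ℝ) - (i : ℝ) + 1) / (i : ℝ))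

/-- The point `s = (2α + 1, −5α²)`, the bottom endpoint of the vertical segment `l_v`. -/
def sPt (α : ℕ) : E2 := pt (2 * (α : ℝ) + 1) (-(5 * (α : ℝ) ^ 2))

/-- The point `t = (2α + 1, 0)`, where `l_v` meets the `x`-axis. -/
def tPt (α : ℕ) : E2 := pt (2 * (α : ℝ) + 1) 0

/-- The edges of the geometric graph `H_b(α, ε)`, given in one orientation:
the needles `[p i, p′ i]` for `1 ≤ i ≤ 2α`; for `2 ≤ k ≤ α` the four edges joining each
of `p (2k−1)`, `p (2k)` to each of `p′ (2k−3)`, `p′ (2k−2)`; the edges from `s` to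
`p′ (2α−1)` and `p′ (2α)`; and the edges from `t` to `p 1` and `p 2`. -/
def HbAdjAux (α : ℕ) (ε : ℝ) (x y : E2) : Prop :=
  (∃ i : ℕ, 1 ≤ i ∧ i ≤ 2 * α ∧ x = needleP α i ∧ y = needleP' α ε i) ∨
  (∃ k : ℕ, 2 ≤ k ∧ k ≤ α ∧
    (x = needleP α (2 * k - 1) ∨ x = needleP α (2 * k)) ∧
    (y = needleP' α ε (2 * k - 3) ∨ y = needleP' α ε (2 * k - 2))) ∨
  (x = sPt α ∧ (y = needleP' α ε (2 * α - 1) ∨ y = needleP' α ε (2 * α))) ∨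
  (x = tPt α ∧ (y = needleP α 1 ∨ y = needleP α 2))

/-- `x` and `y` are joined by an edge of the geometric graph `H_b(α, ε)`. -/
def HbEdge (α : ℕ) (ε : ℝ) (x y : E2) : Prop :=
  HbAdjAux α ε x y ∨ HbAdjAux α ε y x

/-- `w 0, w 1, …, w m` is a walk in `H_b(α, ε)` from `s` to `t`: it starts at `s`,
ends at `t`, and consecutive vertices are joined by an edge of `H_b(α, ε)`. -/
def IsHbWalk (α : ℕ) (ε : ℝ) (m : ℕ) (w : ℕ → E2) : Prop :=
  w 0 = sPt α ∧ w m = tPt α ∧ ∀ k < m, HbEdge α ε (w k) (w (k + 1))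

/-- Distances between points of the plane in coordinates. -/
lemma dist_pt (a b c d : ℝ) : dist (pt a b) (pt c d) = √((a - c) ^ 2 + (b - d) ^ 2) := by
  simp [pt, EuclideanSpace.dist_eq, Fin.sum_univ_two, Real.dist_eq, sq_abs]

lemma polyPath_natCast (v : ℕ → E2) (k : ℕ) : polyPath v k = v k := by
  simp [polyPath]

/-- The distance from `t` to `p i`. -/
def needleHeight (α i : ℕ) : ℝ := (i : ℝ) ^ 2 / (2 * (α : ℝ) - (i : ℝ) + 1)

lemma needleHeight_denom_pos {α i : ℕ} (hi : i ≤ 2 * α) : 0 < 2 * (α : ℝ) - (i : ℝ) + 1 := by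
  have : (i : ℝ) ≤ 2 * α := by exact_mod_cast hi
  linarith

lemma needleHeight_lt {α i j : ℕ} (hij : i < j) (hj : j ≤ 2 * α) :
    needleHeight α i < needleHeight α j := by
  have hlt : (i : ℝ) < j := by exact_mod_cast hij
  have hpos := needleHeight_denom_pos hj
  unfold needleHeight
  gcongr

lemma needleHeight_le {α i j : ℕ} (hij : i ≤ j) (hj : j ≤ 2 * α) :
    needleHeight α i ≤ needleHeight α j := by
  rcases hij.eq_or_lt with rfl | h
  · rfl
  · exact (needleHeight_lt h hj).le

lemma le_of_needleHeight_le {α i j : ℕ} (hi : i ≤ 2 * α)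
    (h : needleHeight α i ≤ needleHeight α j) : i ≤ j := by
  by_contra! hlt
  exact absurd h (needleHeight_lt hlt hi).not_ge

lemma lt_of_needleHeight_lt {α i j : ℕ} (hi : i ≤ 2 * α)
    (h : needleHeight α i < needleHeight α j) : i < j := by
  by_contra! hle
  exact absurd h (needleHeight_le hle hi).not_gt

lemma needleHeight_nonneg {α i : ℕ} (hi : i ≤ 2 * α) : 0 ≤ needleHeight α i :=
  div_nonneg (sq_nonneg _) (needleHeight_denom_pos hi).le

lemma needleHeight_pos {α i : ℕ} (h1 : 1 ≤ i) (hi : i ≤ 2 * α) : 0 < needleHeight α i :=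
  (needleHeight_nonneg (Nat.zero_le _)).trans_lt (needleHeight_lt h1 hi)

lemma dist_needleP {α i : ℕ} (hi : i ≤ 2 * α) :
    dist (needleP α i) (tPt α) = needleHeight α i := by
  rw [needleP, tPt, dist_pt, neg_div, ← needleHeight, sub_self, zero_pow two_ne_zero, zero_add,
    sub_zero, neg_sq, Real.sqrt_sq (needleHeight_nonneg hi)]

lemma dist_sPt (α : ℕ) : dist (sPt α) (tPt α) = 5 * (α : ℝ) ^ 2 := by
  rw [sPt, tPt, dist_pt, sub_self, zero_pow two_ne_zero, zero_add, sub_zero, neg_sq,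
    Real.sqrt_sq (by positivity)]

lemma needleHeight_lt_dist_needleP' {α i : ℕ} {ε : ℝ} (h1 : 1 ≤ i) (hi : i ≤ 2 * α)
    (hε : 0 < ε) : needleHeight α i < dist (needleP' α ε i) (tPt α) := by
  have hpos := needleHeight_denom_pos hi
  have hi0 : (0 : ℝ) < i := by exact_mod_cast h1
  have hnonneg := needleHeight_nonneg hi
  have hshift : 0 < ε * (2 * (α : ℝ) - (i : ℝ) + 1) / (i : ℝ) := by positivity
  rw [needleP', tPt, dist_pt, neg_div, ← needleHeight]
  apply Real.lt_sqrt_of_sq_lt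
  nlinarith [mul_nonneg hnonneg hshift.le, sq_nonneg ε, sq_pos_of_pos hshift]

/-- The distance to `t` of the layer just below `p′ i`. -/
def nextHeight (α i : ℕ) : ℝ := if i < 2 * α then needleHeight α (i + 1) else 5 * (α : ℝ) ^ 2

lemma needleHeight_lt_sPt {α i : ℕ} (hα : 1 ≤ α) (hi : i ≤ 2 * α) :
    needleHeight α i < 5 * (α : ℝ) ^ 2 := by
  have hα0 : (0 : ℝ) < α := by exact_mod_cast hα
  refine (needleHeight_le hi le_rfl).trans_lt ?_
  simp only [needleHeight]
  push_cast
  rw [sub_self, zero_add, div_one]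
  nlinarith

lemma needleHeight_lt_nextHeight {α i : ℕ} (hα : 1 ≤ α) (hi : i ≤ 2 * α) :
    needleHeight α i < nextHeight α i := by
  unfold nextHeight
  split_ifs with h
  · exact needleHeight_lt (Nat.lt_succ_self i) h
  · exact needleHeight_lt_sPt hα hi

lemma nextHeight_le {α i j : ℕ} (hij : i < j) (hj : j ≤ 2 * α) :
    nextHeight α i ≤ needleHeight α j := by
  rw [nextHeight, if_pos (hij.trans_le hj)]
  exact needleHeight_le hij hj

lemma nextHeight_le_sPt {α i : ℕ} (hα : 1 ≤ α) : nextHeight α i ≤ 5 * (α : ℝ) ^ 2 := by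
  unfold nextHeight
  split_ifs with h
  · exact (needleHeight_lt_sPt hα h).le
  · rfl

open Filter Topology in
/-- For short needles, every `p′ i` is closer to `t` than the layer below it. -/
lemma exists_needle_length {α : ℕ} (hα : 1 ≤ α) :
    ∃ ε₀ : ℝ, 0 < ε₀ ∧ ∀ ε : ℝ, 0 < ε → ε ≤ ε₀ → ∀ i : ℕ, 1 ≤ i → i ≤ 2 * α →
      dist (needleP' α ε i) (tPt α) < nextHeight α i := by
  have hev : ∀ᶠ ε in 𝓝 (0 : ℝ), ∀ i ∈ Finset.Icc 1 (2 * α),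
      dist (needleP' α ε i) (tPt α) < nextHeight α i := by
    rw [Filter.eventually_all_finset]
    intro i hi
    have hi2 : i ≤ 2 * α := (Finset.mem_Icc.mp hi).2
    have hcont : Continuous fun ε : ℝ => dist (needleP' α ε i) (tPt α) := by
      simp only [needleP', tPt, dist_pt]
      fun_prop
    refine hcont.continuousAt.eventually_lt continuousAt_const ?_
    have hzero : needleP' α 0 i = needleP α i := by simp [needleP', needleP]
    rw [hzero, dist_needleP hi2]
    exact needleHeight_lt_nextHeight hα hi2
  obtain ⟨δ, hδ, h⟩ := Metric.eventually_nhds_iff.mp hev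
  refine ⟨δ / 2, half_pos hδ, fun ε hε hle i h1 h2 => h ?_ i (Finset.mem_Icc.mpr ⟨h1, h2⟩)⟩
  rw [Real.dist_eq, sub_zero, abs_of_pos hε]
  linarith

/-- Along an increasing-chord path the distance to the endpoint never increases. -/
lemma IncreasingChord.dist_last_le {n : ℕ} {v : ℕ → E2} (h : IncreasingChord n v) {k l : ℕ}
    (hkl : k ≤ l) (hl : l ≤ n) : dist (v l) (v n) ≤ dist (v k) (v n) := by
  simpa only [polyPath_natCast] using h k l n n (Nat.cast_nonneg k) (Nat.cast_le.mpr hkl)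
    (Nat.cast_le.mpr hl) le_rfl le_rfl

section Edges

variable {α : ℕ} {ε : ℝ} {x y : E2} {j : ℕ}

/-- An edge that crosses the distance of `p (2j − 1)` towards `t` leaves from the `j`-th layer. -/
lemma HbEdge.eq_needleP_of_crossing (hα : 1 ≤ α) (hε : 0 < ε)
    (hshort : ∀ i : ℕ, 1 ≤ i → i ≤ 2 * α → dist (needleP' α ε i) (tPt α) < nextHeight α i)
    (hj1 : 1 ≤ j) (hjα : j ≤ α) (hxy : HbEdge α ε x y)
    (hx : needleHeight α (2 * j - 1) ≤ dist x (tPt α))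
    (hy : dist y (tPt α) < needleHeight α (2 * j - 1)) :
    x = needleP α (2 * j - 1) ∨ x = needleP α (2 * j) := by
  have hjpos : 0 < needleHeight α (2 * j - 1) := needleHeight_pos (by omega) (by omega)
  have index_le : ∀ i, 1 ≤ i → i ≤ 2 * α →
      needleHeight α (2 * j - 1) ≤ dist (needleP' α ε i) (tPt α) → 2 * j - 1 ≤ i := by
    intro i h1 h2 h
    by_contra! hlt
    exact absurd (h.trans_lt (hshort i h1 h2)) (nextHeight_le hlt (by omega)).not_gt
  have lt_index : ∀ i, 1 ≤ i → i ≤ 2 * α →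
      dist (needleP' α ε i) (tPt α) < needleHeight α (2 * j - 1) → i < 2 * j - 1 :=
    fun i h1 h2 h => lt_of_needleHeight_lt (by omega)
      ((needleHeight_lt_dist_needleP' h1 h2 hε).trans h)
  rcases hxy with (⟨i, h1, h2, rfl, rfl⟩ | ⟨k, h1, h2, hp, hp'⟩ | ⟨rfl, hp'⟩ | ⟨rfl, hp⟩) |
    (⟨i, h1, h2, rfl, rfl⟩ | ⟨k, h1, h2, hp, hp'⟩ | ⟨rfl, hp'⟩ | ⟨rfl, hp⟩)
  · rw [dist_needleP h2] at hx
    have := lt_index i h1 h2 hy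
    have := le_of_needleHeight_le (by omega) hx
    omega
  · obtain ⟨a, ha, rfl⟩ : ∃ a, (a = 2 * k - 1 ∨ a = 2 * k) ∧ x = needleP α a := by grind
    obtain ⟨b, hb, rfl⟩ : ∃ b, (b = 2 * k - 3 ∨ b = 2 * k - 2) ∧ y = needleP' α ε b := by grind
    rw [dist_needleP (by omega)] at hx
    have := lt_index b (by omega) (by omega) hy
    have := le_of_needleHeight_le (by omega) hx
    obtain rfl : k = j := by omega
    exact hp
  · obtain ⟨b, hb, rfl⟩ : ∃ b, (b = 2 * α - 1 ∨ b = 2 * α) ∧ y = needleP' α ε b := by grind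
    have := lt_index b (by omega) (by omega) hy
    omega
  · rw [dist_self] at hx
    linarith
  · rw [dist_needleP h2] at hy
    have := index_le i h1 h2 hx
    have := lt_of_needleHeight_lt (by omega) hy
    omega
  · obtain ⟨a, ha, rfl⟩ : ∃ a, (a = 2 * k - 1 ∨ a = 2 * k) ∧ y = needleP α a := by grind
    obtain ⟨b, hb, rfl⟩ : ∃ b, (b = 2 * k - 3 ∨ b = 2 * k - 2) ∧ x = needleP' α ε b := by grind
    rw [dist_needleP (by omega)] at hy
    have := index_le b (by omega) (by omega) hx
    have := lt_of_needleHeight_lt (by omega) hy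
    omega
  · rw [dist_sPt] at hy
    exact absurd hy (needleHeight_lt_sPt hα (by omega)).not_gt
  · obtain ⟨a, ha, rfl⟩ : ∃ a, (a = 1 ∨ a = 2) ∧ x = needleP α a := by grind
    rw [dist_needleP (by omega)] at hx
    have := le_of_needleHeight_le (by omega) hx
    obtain rfl : j = 1 := by omega
    exact hp

/-- An edge leaving the `j`-th layer that does not move away from `t` moves closer to `t` than
the whole `j`-th layer. -/
lemma HbEdge.dist_lt_of_needleP (hα : 1 ≤ α) (hε : 0 < ε)
    (hshort : ∀ i : ℕ, 1 ≤ i → i ≤ 2 * α → dist (needleP' α ε i) (tPt α) < nextHeight α i)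
    (hj1 : 1 ≤ j) (hjα : j ≤ α) (hxy : HbEdge α ε x y)
    (hx : x = needleP α (2 * j - 1) ∨ x = needleP α (2 * j))
    (hle : dist y (tPt α) ≤ dist x (tPt α)) :
    dist y (tPt α) < needleHeight α (2 * j - 1) := by
  obtain ⟨c, hc, hxc⟩ : ∃ c, (c = 2 * j - 1 ∨ c = 2 * j) ∧ x = needleP α c := by grind
  have hdx : dist x (tPt α) = needleHeight α c := hxc ▸ dist_needleP (by omega)
  have ne_needleP' : ∀ i, 1 ≤ i → i ≤ 2 * α → x ≠ needleP' α ε i := by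
    rintro i h1 h2 rfl
    have hlo := needleHeight_lt_dist_needleP' h1 h2 hε
    have hhi := hshort i h1 h2
    rw [hdx] at hlo hhi
    have := lt_of_needleHeight_lt (by omega) hlo
    exact absurd hhi (nextHeight_le this (by omega)).not_gt
  rcases hxy with (⟨i, h1, h2, rfl, rfl⟩ | ⟨k, h1, h2, hp, hp'⟩ | ⟨rfl, hp'⟩ | ⟨rfl, hp⟩) |
    (⟨i, h1, h2, rfl, rfl⟩ | ⟨k, h1, h2, hp, hp'⟩ | ⟨rfl, hp'⟩ | ⟨rfl, hp⟩)
  · rw [dist_needleP h2] at hle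
    exact absurd hle (needleHeight_lt_dist_needleP' h1 h2 hε).not_ge
  · obtain ⟨a, ha, rfl⟩ : ∃ a, (a = 2 * k - 1 ∨ a = 2 * k) ∧ x = needleP α a := by grind
    obtain ⟨b, hb, rfl⟩ : ∃ b, (b = 2 * k - 3 ∨ b = 2 * k - 2) ∧ y = needleP' α ε b := by grind
    rw [dist_needleP (by omega)] at hdx
    have := le_of_needleHeight_le (by omega) hdx.le
    have := le_of_needleHeight_le (by omega) hdx.ge
    exact (hshort b (by omega) (by omega)).trans_le (nextHeight_le (by omega) (by omega))
  · rw [dist_sPt] at hdx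
    exact absurd hdx (needleHeight_lt_sPt hα (by omega)).ne'
  · rw [dist_self] at hdx
    exact absurd hdx (needleHeight_pos (by omega) (by omega)).ne
  · exact absurd rfl (ne_needleP' i h1 h2)
  · rcases hp' with h | h
    · exact absurd h (ne_needleP' _ (by omega) (by omega))
    · exact absurd h (ne_needleP' _ (by omega) (by omega))
  · rw [dist_sPt, hdx] at hle
    exact absurd hle (needleHeight_lt_sPt hα (by omega)).not_ge
  · rw [dist_self]
    exact needleHeight_pos (by omega) (by omega)

end Edges

/-- For every integer `α ≥ 1` there is `ε₀ > 0` such that for all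
`0 < ε ≤ ε₀`: every walk in `H_b(α, ε)` from `s` to `t` whose associated polygonal path
is increasing-chord passes, for each `1 ≤ j ≤ α`, through exactly one of the two
vertices `p (2j−1)` and `p (2j)`. -/
theorem increasingChord_walk_passes_exactly_one :
    ∀ α : ℕ, 1 ≤ α → ∃ ε₀ : ℝ, 0 < ε₀ ∧ ∀ ε : ℝ, 0 < ε → ε ≤ ε₀ →
      ∀ (m : ℕ) (w : ℕ → E2), IsHbWalk α ε m w → IncreasingChord m w →
        ∀ j : ℕ, 1 ≤ j → j ≤ α →
          Xor' (∃ k ≤ m, w k = needleP α (2 * j - 1))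
               (∃ k ≤ m, w k = needleP α (2 * j)) := by
  intro α hα
  obtain ⟨ε₀, hε₀, hshort⟩ := exists_needle_length hα
  refine ⟨ε₀, hε₀, fun ε hε hle m w ⟨hw0, hwm, hedge⟩ hchord j hj1 hjα => ?_⟩
  have hmono : ∀ k l, k ≤ l → l ≤ m → dist (w l) (tPt α) ≤ dist (w k) (tPt α) :=
    fun k l hkl hl => hwm ▸ hchord.dist_last_le hkl hl
  have hheight : needleHeight α (2 * j - 1) ≤ needleHeight α (2 * j) :=
    needleHeight_le (by omega) (by omega)
  have hdist : ∀ k, w k = needleP α (2 * j - 1) ∨ w k = needleP α (2 * j) →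
      needleHeight α (2 * j - 1) ≤ dist (w k) (tPt α) := by
    rintro k (h | h) <;> rw [h, dist_needleP (by omega)]
    exact hheight
  have hunique : ∀ k l, w k = needleP α (2 * j - 1) ∨ w k = needleP α (2 * j) →
      w l = needleP α (2 * j - 1) ∨ w l = needleP α (2 * j) → l ≤ m → l ≤ k := by
    intro k l hk hl hlm
    by_contra! hkl
    have hnext := (hedge k (by omega)).dist_lt_of_needleP hα hε (hshort ε hε hle) hj1 hjα hk
      (hmono k (k + 1) (by omega) (by omega))
    exact absurd ((hmono (k + 1) l hkl hlm).trans_lt hnext) (hdist l hl).not_gt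
  have hexists : ∃ k ≤ m, w k = needleP α (2 * j - 1) ∨ w k = needleP α (2 * j) := by
    have hpos : 0 < needleHeight α (2 * j - 1) := needleHeight_pos (by omega) (by omega)
    have hreach : ∃ k, dist (w k) (tPt α) < needleHeight α (2 * j - 1) :=
      ⟨m, by rwa [hwm, dist_self]⟩
    classical
    have hfind := Nat.find_spec hreach
    have hfind_le : Nat.find hreach ≤ m := Nat.find_min' hreach (by rwa [hwm, dist_self])
    rcases hk : Nat.find hreach with _ | k
    · rw [hk, hw0, dist_sPt] at hfind
      exact absurd hfind (needleHeight_lt_sPt hα (by omega)).not_gt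
    · rw [hk] at hfind hfind_le
      refine ⟨k, by omega, (hedge k hfind_le).eq_needleP_of_crossing hα hε (hshort ε hε hle)
        hj1 hjα (not_lt.mp (Nat.find_min hreach (by omega))) hfind⟩
  refine (xor_iff_or_and_not_and _ _).mpr ⟨?_, ?_⟩
  · obtain ⟨k, hkm, h | h⟩ := hexists
    · exact Or.inl ⟨k, hkm, h⟩
    · exact Or.inr ⟨k, hkm, h⟩
  · rintro ⟨⟨k, hkm, hk⟩, l, hlm, hl⟩
    obtain rfl : k = l := le_antisymm (hunique l k (Or.inr hl) (Or.inl hk) hkm)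
      (hunique k l (Or.inl hk) (Or.inr hl) hlm)
    have hne : needleHeight α (2 * j - 1) < needleHeight α (2 * j) :=
      needleHeight_lt (by omega) (by omega)
    rw [← dist_needleP (by omega), ← dist_needleP (by omega), ← hk, ← hl] at hne
    exact lt_irrefl _ hne
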